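/- Let p, q ∈ ℝ² with q ≠ 0 and p·q = 0, let k := p + iq ∈ ℂ² (componentwise), and set E := |p|² − |q|² ∈ ℝ. Define, for x ∈ ℝ²\{0}, g(x) := −(2π)⁻²·lim_{N→∞} ∫_{‖ξ‖≤N} e^{i x·ξ}·(‖ξ‖² + 2 p·ξ + 2i q·ξ)⁻¹ dξ (this limit exists for x ≠ 0). Then the function G(x) := e^{i k·x}·g(x) is twice continuously differentiable on ℝ²\{0} and satisfies −ΔG(x) = E·G(x) for all x ≠ 0. Consequently, for every constant c ∈ ℂ the function ψ(x) := e^{i k·x}(1 + c·g(x)) satisfies the Schrödinger equation −Δψ = Eψ on ℝ²\{0}. -/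

import Mathlib

open MeasureTheory Real Filter Topology

/-- The Laplacian of `f : ℝ² → ℂ` at `x`, as the sum of the second derivatives
in the standard coordinate directions. -/
noncomputable def laplacian2 (f : EuclideanSpace ℝ (Fin 2) → ℂ)
    (x : EuclideanSpace ℝ (Fin 2)) : ℂ :=
  ∑ i : Fin 2,
    fderiv ℝ (fun y => fderiv ℝ f y (EuclideanSpace.single i 1)) x
      (EuclideanSpace.single i 1)

noncomputable def fadM (φ : ℝ → ℝ) (r : ℝ) : ℝ :=
  ∫ t in Set.Ioi (1:ℝ), φ t * Real.exp (-(r * t))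

def fadNice (φ : ℝ → ℝ) : Prop :=
  Measurable φ ∧ ∃ C : ℝ, ∃ m : ℕ, ∀ t : ℝ, 1 < t → |φ t| ≤ C * t ^ m

lemma fadNice_mul {φ : ℝ → ℝ} (h : fadNice φ) : fadNice (fun t => t * φ t) := by
  obtain ⟨hm, C, m, hC⟩ := h
  refine ⟨measurable_id.mul hm, C, m + 1, fun t ht => ?_⟩
  rw [abs_mul, abs_of_pos (by linarith), pow_succ]
  have := hC t ht
  nlinarith

lemma fad_pow_exp (m : ℕ) {b : ℝ} (hb : 0 < b) :
    IntegrableOn (fun t : ℝ => t ^ m * Real.exp (-(b * t))) (Set.Ioi 1) := by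
  have h := integrableOn_rpow_mul_exp_neg_mul_rpow (p := 1) (s := m) (b := b)
    (by have : (0:ℝ) ≤ m := Nat.cast_nonneg m
        linarith) one_pos hb
  refine (h.mono_set (Set.Ioi_subset_Ioi zero_le_one)).congr_fun ?_ measurableSet_Ioi
  intro t ht
  simp [Real.rpow_natCast]

lemma fadNice_int {φ : ℝ → ℝ} (h : fadNice φ) {r : ℝ} (hr : 0 < r) :
    IntegrableOn (fun t => φ t * Real.exp (-(r * t))) (Set.Ioi 1) := by
  obtain ⟨hm, C, m, hC⟩ := h
  refine Integrable.mono' ((fad_pow_exp m hr).const_mul C) ?_ ?_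
  · exact Measurable.aestronglyMeasurable (by fun_prop)
  · filter_upwards [ae_restrict_mem measurableSet_Ioi] with t ht
    rw [norm_mul, Real.norm_eq_abs, Real.norm_eq_abs, Real.abs_exp, ← mul_assoc]
    exact mul_le_mul_of_nonneg_right (hC t ht) (Real.exp_nonneg _)

lemma fadM_hasDerivAt {φ : ℝ → ℝ} (h : fadNice φ) {r : ℝ} (hr : 0 < r) :
    HasDerivAt (fadM φ) (-(fadM (fun t => t * φ t) r)) r := by
  obtain ⟨hm', C, m, hC⟩ := fadNice_mul h
  have hm := h.1
  have key := hasDerivAt_integral_of_dominated_loc_of_deriv_le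
    (μ := volume.restrict (Set.Ioi (1:ℝ)))
    (F := fun r t => φ t * Real.exp (-(r * t)))
    (F' := fun r t => -((t * φ t) * Real.exp (-(r * t))))
    (bound := fun t => C * (t ^ m * Real.exp (-((r / 2) * t))))
    (x₀ := r) (s := Set.Ioi (r / 2)) (Ioi_mem_nhds (by linarith)) ?_ ?_ ?_ ?_ ?_ ?_
  · have := key.2
    rw [integral_neg] at this
    exact this
  · exact Filter.Eventually.of_forall fun x => Measurable.aestronglyMeasurable (by fun_prop)
  · exact fadNice_int h hr
  · exact Measurable.aestronglyMeasurable (by fun_prop)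
  · filter_upwards [ae_restrict_mem measurableSet_Ioi] with t ht x hx
    have ht' : (1:ℝ) < t := ht
    have hx' : r / 2 < x := hx
    rw [norm_neg, norm_mul, Real.norm_eq_abs, Real.norm_eq_abs, Real.abs_exp, ← mul_assoc]
    have h1 := hC t ht
    have h2 : Real.exp (-(x * t)) ≤ Real.exp (-((r / 2) * t)) := by
      apply Real.exp_le_exp.2
      nlinarith
    exact mul_le_mul h1 h2 (Real.exp_nonneg _) ((abs_nonneg _).trans h1)
  · exact (fad_pow_exp m (by linarith)).const_mul C
  · refine Filter.Eventually.of_forall fun t x _ => ?_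
    have : HasDerivAt (fun x : ℝ => -(x * t)) (-t) x := by
      simpa using! ((hasDerivAt_id x).mul_const t).neg
    have := (this.exp).const_mul (φ t)
    exact this.congr_deriv (by ring)

lemma fadM_contDiffOn (n : ℕ) : ∀ {φ : ℝ → ℝ}, fadNice φ →
    ContDiffOn ℝ n (fadM φ) (Set.Ioi 0) := by
  induction n with
  | zero =>
    intro φ h
    simp only [Nat.cast_zero, contDiffOn_zero]
    exact fun r hr => (fadM_hasDerivAt h hr).continuousAt.continuousWithinAt
  | succ n ih =>
    intro φ h
    rw [Nat.cast_succ, contDiffOn_succ_iff_deriv_of_isOpen isOpen_Ioi]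
    refine ⟨fun r hr => (fadM_hasDerivAt h hr).differentiableAt.differentiableWithinAt,
      by simp, ?_⟩
    exact (ih (fadNice_mul h)).neg.congr fun r hr => (fadM_hasDerivAt h hr).deriv

/-- the weight `e^{E/t}/t` -/
noncomputable def fadW (E t : ℝ) : ℝ := Real.exp (E / t) / t

lemma fadW_nice (E : ℝ) : fadNice (fadW E) := by
  refine ⟨by unfold fadW; fun_prop, Real.exp |E|, 0, fun t ht => ?_⟩
  have h0 : (0:ℝ) < t := by linarith
  unfold fadW
  rw [abs_div, Real.abs_exp, abs_of_pos h0, pow_zero, mul_one]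
  rw [div_le_iff₀ h0]
  have : Real.exp (E / t) ≤ Real.exp |E| := by
    apply Real.exp_le_exp.2
    rw [div_le_iff₀ h0]
    nlinarith [le_abs_self E, abs_nonneg E]
  nlinarith [Real.exp_pos |E|]

lemma fadM_ode (E : ℝ) {r : ℝ} (hr : 0 < r) :
    r * fadM (fun t => t * (t * fadW E t)) r - fadM (fun t => t * fadW E t) r
      = Real.exp (-r + E) - E * fadM (fadW E) r := by
  have n0 := fadW_nice E
  have n1 := fadNice_mul n0
  have n2 := fadNice_mul n1
  have i0 := fadNice_int n0 hr
  have i1 := fadNice_int n1 hr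
  have i2 := fadNice_int n2 hr
  have key := integral_Ioi_of_hasDerivAt_of_tendsto' (a := (1:ℝ)) (m := (0:ℝ))
    (f := fun t => t * (Real.exp (E / t) * Real.exp (-(r * t))))
    (f' := fun t => (t * fadW E t * Real.exp (-(r * t)) -
      r * (t * (t * fadW E t) * Real.exp (-(r * t)))) - E * (fadW E t * Real.exp (-(r * t))))
    ?_ ((i1.sub (i2.const_mul r)).sub (i0.const_mul E)) ?_
  · have i3 : IntegrableOn (fun t => t * fadW E t * Real.exp (-(r * t)) -
        r * (t * (t * fadW E t) * Real.exp (-(r * t)))) (Set.Ioi 1) := i1.sub (i2.const_mul r)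
    rw [integral_sub i3 (i0.const_mul E),
      integral_sub i1 (i2.const_mul r), integral_const_mul, integral_const_mul] at key
    unfold fadM
    have h2 : Real.exp (-r + E) = 1 * (Real.exp (E / 1) * Real.exp (-(r * 1))) := by
      rw [← Real.exp_add]; ring_nf
    rw [h2]
    linarith
  · intro t ht
    have h0 : (0:ℝ) < t := lt_of_lt_of_le one_pos ht
    have d1 : HasDerivAt (fun t : ℝ => -(r * t)) (-r) t := by
      simpa using! ((hasDerivAt_id t).const_mul r).neg
    have d2 : HasDerivAt (fun t : ℝ => E / t) (-E / t ^ 2) t := by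
      simpa [div_eq_mul_inv] using ((hasDerivAt_inv h0.ne').const_mul E)
    have := (hasDerivAt_id t).mul (d2.exp.mul d1.exp)
    refine this.congr_deriv ?_
    simp only [fadW, id, Pi.mul_apply]
    field_simp
    ring
  · have h1 : Tendsto (fun t : ℝ => t * Real.exp (-(r * t))) atTop (𝓝 0) := by
      have := Real.tendsto_pow_mul_exp_neg_atTop_nhds_zero 1
      have h2 : Tendsto (fun t : ℝ => r * t) atTop atTop := tendsto_id.const_mul_atTop hr
      have h3 := (this.comp h2).const_mul r⁻¹
      simp only [mul_zero] at h3
      refine h3.congr fun t => ?_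
      simp only [Function.comp, pow_one]
      field_simp
    have h2 : Tendsto (fun t : ℝ => Real.exp (E / t)) atTop (𝓝 1) := by
      have : Tendsto (fun t : ℝ => E / t) atTop (𝓝 0) := tendsto_const_nhds.div_atTop tendsto_id
      simpa using! (Real.continuous_exp.tendsto 0).comp this
    have := h2.mul h1
    simp only [mul_zero] at this
    exact this.congr fun t => by ring

abbrev FadV := EuclideanSpace ℝ (Fin 2)

lemma fad_lap_of {f : FadV → ℂ} {x : FadV} (f1 : Fin 2 → FadV → ℂ) (f2 : Fin 2 → ℂ)
    (h1 : ∀ i, ∀ᶠ y in 𝓝 x, fderiv ℝ f y (EuclideanSpace.single i 1) = f1 i y)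
    (h2 : ∀ i, fderiv ℝ (f1 i) x (EuclideanSpace.single i 1) = f2 i) :
    laplacian2 f x = ∑ i, f2 i := by
  unfold laplacian2
  refine Finset.sum_congr rfl fun i _ => ?_
  rw [Filter.EventuallyEq.fderiv_eq (h1 i), h2]

lemma fad_lap_congr {f g : FadV → ℂ} {x : FadV} (h : f =ᶠ[𝓝 x] g) :
    laplacian2 f x = laplacian2 g x := by
  refine fad_lap_of _ _ (fun i => ?_) (fun i => rfl)
  filter_upwards [h.fderiv (𝕜 := ℝ)] with y hy
  rw [hy]

lemma fad_diff1 {f : FadV → ℂ} {x : FadV} (hf : ContDiffAt ℝ 2 f x) :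
    ∀ᶠ y in 𝓝 x, DifferentiableAt ℝ f y := by
  filter_upwards [hf.eventually (by simp)] with y hy
  exact hy.differentiableAt (by simp)

lemma fad_diff2 {f : FadV → ℂ} {x : FadV} (hf : ContDiffAt ℝ 2 f x) (v : FadV) :
    DifferentiableAt ℝ (fun y => fderiv ℝ f y v) x := by
  have : ContDiffAt ℝ 1 (fderiv ℝ f) x := hf.fderiv_right (by norm_num)
  exact (this.differentiableAt (by simp)).clm_apply (differentiableAt_const v)

lemma fad_lap_add {f g : FadV → ℂ} {x : FadV} (hf : ContDiffAt ℝ 2 f x)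
    (hg : ContDiffAt ℝ 2 g x) :
    laplacian2 (fun y => f y + g y) x = laplacian2 f x + laplacian2 g x := by
  unfold laplacian2
  rw [← Finset.sum_add_distrib]
  refine fad_lap_of (fun i y => fderiv ℝ f y (EuclideanSpace.single i 1) +
    fderiv ℝ g y (EuclideanSpace.single i 1)) _ (fun i => ?_) (fun i => ?_)
  · filter_upwards [fad_diff1 hf, fad_diff1 hg] with y h1 h2
    rw [fderiv_fun_add h1 h2]; rfl
  · rw [fderiv_fun_add (fad_diff2 hf _) (fad_diff2 hg _)]; rfl

lemma fad_lap_const_mul {f : FadV → ℂ} {x : FadV} (hf : ContDiffAt ℝ 2 f x) (c : ℂ) :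
    laplacian2 (fun y => c * f y) x = c * laplacian2 f x := by
  unfold laplacian2
  rw [Finset.mul_sum]
  refine fad_lap_of (fun i y => c * fderiv ℝ f y (EuclideanSpace.single i 1))
    _ (fun i => ?_) (fun i => ?_)
  · filter_upwards [fad_diff1 hf] with y h1
    rw [fderiv_const_mul h1]; simp
  · rw [fderiv_const_mul (fad_diff2 hf _)]; simp

lemma fad_normsq_hasFDerivAt (y : FadV) :
    HasFDerivAt (fun y : FadV => ‖y‖ ^ 2 / 4) ((1 / 2 : ℝ) • innerSL ℝ y) y := by
  have := (hasStrictFDerivAt_norm_sq y).hasFDerivAt.const_mul (1 / 4 : ℝ)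
  have h2 : HasFDerivAt (fun y : FadV => ‖y‖ ^ 2 / 4) _ y :=
    this.congr_of_eventuallyEq (Filter.Eventually.of_forall fun y => by simp; ring)
  refine h2.congr_fderiv ?_
  ext i
  simp
  ring

lemma fad_inner_single (y : FadV) (i : Fin 2) :
    inner ℝ y (EuclideanSpace.single i (1:ℝ)) = y i := by
  rw [EuclideanSpace.inner_single_right]; simp

noncomputable def fadWx (E : ℝ) (x : FadV) : ℂ := ((fadM (fadW E) (‖x‖ ^ 2 / 4) : ℝ) : ℂ)

lemma fad_pos {x : FadV} (hx : x ≠ 0) : 0 < ‖x‖ ^ 2 / 4 := by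
  have := norm_pos_iff.2 hx
  positivity

lemma fadWx_contDiffAt (E : ℝ) {x : FadV} (hx : x ≠ 0) : ContDiffAt ℝ 2 (fadWx E) x := by
  have h1 : ContDiffAt ℝ 2 (fadM (fadW E)) (‖x‖ ^ 2 / 4) :=
    ((fadM_contDiffOn 2 (fadW_nice E)).contDiffAt (Ioi_mem_nhds (fad_pos hx)))
  have h2 : ContDiffAt ℝ 2 (fun x : FadV => ‖x‖ ^ 2 / 4) x :=
    ((contDiff_norm_sq ℝ).div_const 4).contDiffAt
  exact Complex.ofRealCLM.contDiff.contDiffAt.comp x (ContDiffAt.comp (g := fadM (fadW E)) x h1 h2)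

lemma fad_radial_fderiv {φ : ℝ → ℝ} (h : fadNice φ) {y : FadV} (hy : y ≠ 0) :
    HasFDerivAt (fun y : FadV => fadM φ (‖y‖ ^ 2 / 4))
      (-(fadM (fun t => t * φ t) (‖y‖ ^ 2 / 4)) • ((1 / 2 : ℝ) • innerSL ℝ y)) y :=
  HasDerivAt.comp_hasFDerivAt (h₂ := fadM φ) y (fadM_hasDerivAt h (fad_pos hy)) (fad_normsq_hasFDerivAt y)

lemma fadWx_lap (E : ℝ) {x : FadV} (hx : x ≠ 0) :
    laplacian2 (fadWx E) x = ((Real.exp (-(‖x‖ ^ 2 / 4) + E) : ℝ) : ℂ) - E * fadWx E x := by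
  have n0 := fadW_nice E
  have n1 := fadNice_mul n0
  have key := fad_lap_of (f := fadWx E) (x := x)
    (fun i y => ((-(fadM (fun t => t * fadW E t) (‖y‖ ^ 2 / 4)) * ((1 / 2 : ℝ) * y i) : ℝ) : ℂ))
    (fun i => ((-(fadM (fun t => t * fadW E t) (‖x‖ ^ 2 / 4)) * (1 / 2 : ℝ) +
      (fadM (fun t => t * (t * fadW E t)) (‖x‖ ^ 2 / 4)) * ((1 / 2 : ℝ) * x i) ^ 2 : ℝ) : ℂ))
    ?_ ?_
  · rw [key, ← Complex.ofReal_sum]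
    unfold fadWx
    norm_cast
    rw [← fadM_ode E (fad_pos hx), EuclideanSpace.norm_sq_eq]
    simp only [Fin.sum_univ_two, Real.norm_eq_abs, sq_abs]
    ring
  · intro i
    filter_upwards [isOpen_ne.mem_nhds hx] with y hy
    have := (Complex.ofRealCLM.hasFDerivAt (x := fadM (fadW E) (‖y‖ ^ 2 / 4))).comp y
      (fad_radial_fderiv n0 hy)
    have h2 : HasFDerivAt (fadWx E) _ y := this
    rw [h2.fderiv]
    simp [fad_inner_single]
  · intro i
    have hi : HasFDerivAt (fun y : FadV => (1 / 2 : ℝ) * y i)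
        ((1 / 2 : ℝ) • (EuclideanSpace.proj i : FadV →L[ℝ] ℝ)) x :=
      (EuclideanSpace.proj i : FadV →L[ℝ] ℝ).hasFDerivAt.const_mul _
    have := (Complex.ofRealCLM.hasFDerivAt).comp x ((fad_radial_fderiv n1 hx).neg.mul hi)
    have h2 : HasFDerivAt (fun y : FadV => ((-(fadM (fun t => t * fadW E t) (‖y‖ ^ 2 / 4)) * ((1 / 2 : ℝ) * y i) : ℝ) : ℂ)) _ x := this
    rw [h2.fderiv]
    simp [fad_inner_single]
    ring

noncomputable def fadP (p q ξ : FadV) : ℂ :=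
  ((‖ξ‖ ^ 2 + 2 * (inner ℝ p ξ : ℝ) : ℝ) : ℂ) + 2 * Complex.I * ((inner ℝ q ξ : ℝ) : ℂ)

noncomputable def fadek (p q x : FadV) : ℂ :=
  Complex.exp (Complex.I * (((inner ℝ p x : ℝ) : ℂ) + Complex.I * ((inner ℝ q x : ℝ) : ℂ)))

noncomputable def fadk (p q : FadV) (i : Fin 2) : ℂ := (p i : ℂ) + Complex.I * (q i : ℂ)

noncomputable def fadF (h : FadV → ℂ) (x : FadV) : ℂ :=
  ∫ ξ, Complex.exp (Complex.I * ((inner ℝ x ξ : ℝ) : ℂ)) * h ξ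

def fadDec (h : FadV → ℂ) : Prop :=
  AEStronglyMeasurable h ∧ ∀ n : ℕ, Integrable (fun ξ : FadV => ‖ξ‖ ^ n * ‖h ξ‖)

lemma fadDec_int {h : FadV → ℂ} (hh : fadDec h) : Integrable h := by
  have := hh.2 0
  simp only [pow_zero, one_mul] at this
  exact (integrable_norm_iff hh.1).1 this

lemma fadDec_add {h h' : FadV → ℂ} (hh : fadDec h) (hh' : fadDec h') :
    fadDec (fun ξ => h ξ + h' ξ) := by
  refine ⟨hh.1.add hh'.1, fun n => ?_⟩
  refine ((hh.2 n).add (hh'.2 n)).mono' ?_ ?_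
  · exact ((continuous_norm.pow n).aestronglyMeasurable).mul (hh.1.add hh'.1).norm
  · refine Filter.Eventually.of_forall fun ξ => ?_
    simp only [norm_mul, norm_pow, norm_norm, Pi.add_apply]
    rw [← mul_add]
    gcongr
    exact norm_add_le _ _

lemma fadDec_const {h : FadV → ℂ} (hh : fadDec h) (c : ℂ) : fadDec (fun ξ => c * h ξ) := by
  refine ⟨hh.1.const_mul c, fun n => ?_⟩
  refine ((hh.2 n).const_mul ‖c‖).congr (Filter.Eventually.of_forall fun ξ => ?_)
  simp only [norm_mul]
  ring

lemma fadDec_coord {h : FadV → ℂ} (hh : fadDec h) (i : Fin 2) :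
    fadDec (fun ξ => (ξ i : ℂ) * h ξ) := by
  have hm : AEStronglyMeasurable (fun ξ : FadV => (ξ i : ℂ) * h ξ) := by
    refine AEStronglyMeasurable.mul ?_ hh.1
    exact Continuous.aestronglyMeasurable (by fun_prop)
  refine ⟨hm, fun n => ?_⟩
  refine (hh.2 (n + 1)).mono' ?_ ?_
  · exact ((continuous_norm.pow n).aestronglyMeasurable).mul hm.norm
  · refine Filter.Eventually.of_forall fun ξ => ?_
    simp only [norm_mul, norm_pow, norm_norm, Complex.norm_real]
    rw [pow_succ, mul_assoc]
    gcongr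
    exact PiLp.norm_apply_le ξ i

noncomputable def fadL : FadV →L[ℝ] FadV →L[ℝ] ℝ := (-(1 / (2 * π)) : ℝ) • innerSL ℝ

lemma fadF_eq (h : FadV → ℂ) :
    fadF h = VectorFourier.fourierIntegral Real.fourierChar volume fadL.toLinearMap₁₂ h := by
  funext x
  unfold fadF VectorFourier.fourierIntegral
  congr 1
  funext ξ
  rw [Circle.smul_def, Real.fourierChar_apply, smul_eq_mul]
  congr 2
  simp only [fadL, ContinuousLinearMap.toLinearMap₁₂_apply_apply_apply,
    smul_apply, innerSL_apply_apply ℝ, smul_eq_mul]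
  rw [real_inner_comm x ξ, mul_comm]
  congr 2
  field_simp

lemma fadF_contDiff {h : FadV → ℂ} (hh : fadDec h) : ContDiff ℝ 2 (fadF h) := by
  rw [fadF_eq]
  exact VectorFourier.contDiff_fourierIntegral (N := 2) fadL (fun n _ => hh.2 n)

lemma fadF_fderiv {h : FadV → ℂ} (hh : fadDec h) (x : FadV) (i : Fin 2) :
    fderiv ℝ (fadF h) x (EuclideanSpace.single i 1)
      = fadF (fun ξ => Complex.I * ((ξ i : ℂ) * h ξ)) x := by
  have h1 : Integrable (fun ξ : FadV => ‖ξ‖ * ‖h ξ‖) := by simpa using hh.2 1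
  have I4 : Integrable (fun v => VectorFourier.fourierSMulRight fadL h v) := by
    apply (h1.const_mul ((2 * π * ‖fadL‖))).mono' hh.1.fourierSMulRight
    filter_upwards with v
    exact (VectorFourier.norm_fourierSMulRight_le _ _ _).trans (le_of_eq (by ring))
  have := VectorFourier.hasFDerivAt_fourierIntegral fadL (fadDec_int hh) h1 x
  rw [fadF_eq, fadF_eq, this.fderiv, Real.fourierIntegral_continuousLinearMap_apply' I4]
  congr 1
  funext ξ
  simp only [VectorFourier.fourierSMulRight_apply, fadL, smul_apply,
    innerSL_apply_apply ℝ, fad_inner_single, smul_eq_mul, Complex.real_smul]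
  push_cast
  have : (π : ℂ) ≠ 0 := by exact_mod_cast Real.pi_ne_zero
  field_simp

noncomputable def fadA (p q : FadV) (h : FadV → ℂ) (x : FadV) : ℂ := fadek p q x * fadF h x

lemma fadek_contDiff (p q : FadV) : ContDiff ℝ 2 (fadek p q) := by
  unfold fadek
  have h1 : ∀ p : FadV, ContDiff ℝ 2 (fun x : FadV => ((inner ℝ p x : ℝ) : ℂ)) := fun p =>
    Complex.ofRealCLM.contDiff.comp (contDiff_const.inner ℝ contDiff_id)
  exact (contDiff_const.mul ((h1 p).add (contDiff_const.mul (h1 q)))).cexp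

lemma fadek_fderiv (p q x : FadV) (i : Fin 2) :
    fderiv ℝ (fadek p q) x (EuclideanSpace.single i 1) = Complex.I * fadk p q i * fadek p q x := by
  have h1 : ∀ p : FadV, HasFDerivAt (fun x : FadV => ((inner ℝ p x : ℝ) : ℂ))
      (Complex.ofRealCLM.comp (innerSL ℝ p)) x := fun p =>
    (Complex.ofRealCLM.comp (innerSL ℝ p)).hasFDerivAt
  have := (((h1 p).add ((h1 q).const_mul Complex.I)).const_mul Complex.I).cexp
  have h2 : HasFDerivAt (fadek p q) _ x := this
  rw [h2.fderiv]
  simp [fadk, fadek, fad_inner_single]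
  ring

lemma fadA_contDiff (p q : FadV) {h : FadV → ℂ} (hh : fadDec h) : ContDiff ℝ 2 (fadA p q h) :=
  (fadek_contDiff p q).mul (fadF_contDiff hh)

lemma fad_exp_int {h : FadV → ℂ} (hh : Integrable h) (x : FadV) :
    Integrable (fun ξ : FadV => Complex.exp (Complex.I * ((inner ℝ x ξ : ℝ) : ℂ)) * h ξ) := by
  refine hh.norm.mono' ?_ ?_
  · exact (Continuous.aestronglyMeasurable (by fun_prop)).mul hh.1
  · refine Filter.Eventually.of_forall fun ξ => ?_
    rw [norm_mul, mul_comm Complex.I, Complex.norm_exp_ofReal_mul_I, one_mul]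

lemma fadF_add {h h' : FadV → ℂ} (hh : Integrable h) (hh' : Integrable h') (x : FadV) :
    fadF (fun ξ => h ξ + h' ξ) x = fadF h x + fadF h' x := by
  unfold fadF
  rw [← integral_add (fad_exp_int hh x) (fad_exp_int hh' x)]
  simp only [mul_add]

lemma fadF_const (c : ℂ) (h : FadV → ℂ) (x : FadV) :
    fadF (fun ξ => c * h ξ) x = c * fadF h x := by
  unfold fadF
  rw [← integral_const_mul]
  congr 1
  funext ξ
  ring

noncomputable def fadD (p q : FadV) (i : Fin 2) (h : FadV → ℂ) (ξ : FadV) : ℂ :=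
  Complex.I * fadk p q i * h ξ + Complex.I * ((ξ i : ℂ) * h ξ)

lemma fadD_dec (p q : FadV) (i : Fin 2) {h : FadV → ℂ} (hh : fadDec h) :
    fadDec (fadD p q i h) :=
  fadDec_add (fadDec_const hh _) (fadDec_const (fadDec_coord hh i) _)

lemma fadA_fderiv (p q : FadV) {h : FadV → ℂ} (hh : fadDec h) (x : FadV) (i : Fin 2) :
    fderiv ℝ (fadA p q h) x (EuclideanSpace.single i 1) = fadA p q (fadD p q i h) x := by
  have d1 : DifferentiableAt ℝ (fadek p q) x := (fadek_contDiff p q).differentiable (by simp) x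
  have d2 : DifferentiableAt ℝ (fadF h) x := (fadF_contDiff hh).differentiable (by simp) x
  have : fderiv ℝ (fadA p q h) x = _ := fderiv_mul d1 d2
  rw [this]
  have e : fadF (fadD p q i h) x = Complex.I * fadk p q i * fadF h x +
      fadF (fun ξ => Complex.I * ((ξ i : ℂ) * h ξ)) x := by
    rw [← fadF_const]
    exact fadF_add (fadDec_int (fadDec_const hh _))
      (fadDec_int (fadDec_const (fadDec_coord hh i) _)) x
  simp only [add_apply, smul_apply, smul_eq_mul,
    fadek_fderiv, fadF_fderiv hh, fadA, e]
  ring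

lemma fad_symbol (p q : FadV) (hpq : (inner ℝ p q : ℝ) = 0) (ξ : FadV) :
    ∑ i, (fadk p q i + (ξ i : ℂ)) ^ 2 = fadP p q ξ + ((‖p‖ ^ 2 - ‖q‖ ^ 2 : ℝ) : ℂ) := by
  have h0 : p 0 * q 0 + p 1 * q 1 = 0 := by
    rw [← hpq, PiLp.inner_apply]
    simp [Fin.sum_univ_two]; ring
  have h0' : (p 0 : ℂ) * q 0 + p 1 * q 1 = 0 := by
    rw [← Complex.ofReal_mul, ← Complex.ofReal_mul, ← Complex.ofReal_add, h0, Complex.ofReal_zero]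
  unfold fadP fadk
  rw [EuclideanSpace.norm_sq_eq, EuclideanSpace.norm_sq_eq, EuclideanSpace.norm_sq_eq,
    PiLp.inner_apply, PiLp.inner_apply]
  simp only [Fin.sum_univ_two, Real.norm_eq_abs, sq_abs]
  simp
  linear_combination (2 * Complex.I) * h0' + ((q 0 : ℂ) ^ 2 + (q 1 : ℂ) ^ 2) * Complex.I_sq

lemma fadA_lap (p q : FadV) (hpq : (inner ℝ p q : ℝ) = 0) {h : FadV → ℂ} (hh : fadDec h)
    (hPh : Integrable (fun ξ => fadP p q ξ * h ξ)) (x : FadV) :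
    -laplacian2 (fadA p q h) x =
      fadA p q (fun ξ => fadP p q ξ * h ξ) x + ((‖p‖ ^ 2 - ‖q‖ ^ 2 : ℝ) : ℂ) * fadA p q h x := by
  rw [fad_lap_of (fun i => fadA p q (fadD p q i h)) (fun i => fadA p q (fadD p q i (fadD p q i h)) x)
    (fun i => Filter.Eventually.of_forall fun y => fadA_fderiv p q hh y i)
    (fun i => fadA_fderiv p q (fadD_dec p q i hh) x i)]
  have i0 := fadDec_int (fadD_dec p q 0 (fadD_dec p q 0 hh))
  have i1 := fadDec_int (fadD_dec p q 1 (fadD_dec p q 1 hh))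
  have e1 := fadF_add i0 i1 x
  have e2 := fadF_add hPh ((fadDec_int hh).const_mul ((‖p‖ ^ 2 - ‖q‖ ^ 2 : ℝ) : ℂ)) x
  rw [fadF_const] at e2
  have e3 : (fun ξ => fadD p q 0 (fadD p q 0 h) ξ + fadD p q 1 (fadD p q 1 h) ξ) =
      fun ξ => (-1 : ℂ) * (fadP p q ξ * h ξ + ((‖p‖ ^ 2 - ‖q‖ ^ 2 : ℝ) : ℂ) * h ξ) := by
    funext ξ
    have := fad_symbol p q hpq ξ
    rw [Fin.sum_univ_two] at this
    rw [← add_mul, ← this]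
    simp only [fadD]
    linear_combination (((fadk p q 0 + (ξ 0 : ℂ)) ^ 2 + (fadk p q 1 + (ξ 1 : ℂ)) ^ 2) * h ξ)
      * Complex.I_sq
  rw [e3, fadF_const, e2] at e1
  simp only [Fin.sum_univ_two, fadA]
  linear_combination (fadek p q x) * e1

lemma fadP_continuous (p q : FadV) : Continuous (fadP p q) := by
  unfold fadP
  fun_prop

lemma fadP_re (p q ξ : FadV) : (fadP p q ξ).re = ‖ξ‖ ^ 2 + 2 * (inner ℝ p ξ : ℝ) := by
  simp [fadP, -Complex.ofReal_pow]

lemma fadP_re_ge (p q ξ : FadV) : ‖ξ‖ ^ 2 / 2 - 2 * ‖p‖ ^ 2 ≤ (fadP p q ξ).re := by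
  rw [fadP_re]
  have := abs_real_inner_le_norm p ξ
  have h2 := neg_abs_le (inner ℝ p ξ : ℝ)
  nlinarith [sq_nonneg (‖ξ‖ - 2 * ‖p‖)]

lemma fadP_exp_norm (p q ξ : FadV) {t : ℝ} (ht : 0 < t) :
    ‖Complex.exp (-(fadP p q ξ / (t : ℂ)))‖
      ≤ Real.exp (2 * ‖p‖ ^ 2 / t) * Real.exp (-(‖ξ‖ ^ 2 / (2 * t))) := by
  rw [Complex.norm_exp, ← Real.exp_add]
  apply Real.exp_le_exp.2
  rw [Complex.neg_re, Complex.div_ofReal_re]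
  have h := fadP_re_ge p q ξ
  have : (‖ξ‖ ^ 2 / 2 - 2 * ‖p‖ ^ 2) / t ≤ (fadP p q ξ).re / t := by gcongr
  have e : 2 * ‖p‖ ^ 2 / t + -(‖ξ‖ ^ 2 / (2 * t)) = -((‖ξ‖ ^ 2 / 2 - 2 * ‖p‖ ^ 2) / t) := by
    field_simp
    ring
  linarith

lemma fad_gauss_int {b : ℝ} (hb : 0 < b) :
    Integrable (fun ξ : FadV => Real.exp (-(b * ‖ξ‖ ^ 2))) := by
  have h := (GaussianFourier.integrable_cexp_neg_mul_sq_norm_add_of_euclideanSpace (b := (b:ℂ))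
    (ι := Fin 2) (by simpa using hb) 0 0).norm
  refine h.congr (Filter.Eventually.of_forall fun ξ => ?_)
  simp only [Complex.norm_exp]
  congr 1
  simp [← Complex.ofReal_pow]

lemma fad_expP_int (p q : FadV) {t : ℝ} (ht : 0 < t) :
    Integrable (fun ξ => Complex.exp (-(fadP p q ξ / (t : ℂ)))) := by
  refine ((fad_gauss_int (b := 1 / (2 * t)) (by positivity)).const_mul
    (Real.exp (2 * ‖p‖ ^ 2 / t))).mono' ?_ ?_
  · have := fadP_continuous p q
    exact Continuous.aestronglyMeasurable (by fun_prop)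
  · refine Filter.Eventually.of_forall fun ξ => ?_
    refine (fadP_exp_norm p q ξ ht).trans (le_of_eq ?_)
    congr 3
    ring

lemma fad_gauss (p q : FadV) (hpq : (inner ℝ p q : ℝ) = 0) {t : ℝ} (ht : 0 < t) (x : FadV) :
    fadA p q (fun ξ => Complex.exp (-(fadP p q ξ / (t : ℂ)))) x =
      ((π * t * Real.exp (-(t * (‖x‖ ^ 2 / 4)) + (‖p‖ ^ 2 - ‖q‖ ^ 2) / t) : ℝ) : ℂ) := by
  have htc : (t : ℂ) ≠ 0 := by exact_mod_cast ht.ne'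
  have hF : fadF (fun ξ => Complex.exp (-(fadP p q ξ / (t : ℂ)))) x =
      ∫ v : Fin 2 → ℝ, Complex.exp (-((1 / t : ℝ) : ℂ) * ∑ i, (v i : ℂ) ^ 2 +
        ∑ i, (Complex.I * (x i : ℂ) - 2 * fadk p q i / t) * v i) := by
    unfold fadF
    rw [← (PiLp.volume_preserving_toLp (Fin 2)).integral_comp
      (MeasurableEquiv.toLp 2 _).measurableEmbedding]
    congr 1
    funext v
    rw [← Complex.exp_add]
    congr 1
    unfold fadP fadk
    rw [EuclideanSpace.norm_sq_eq, PiLp.inner_apply, PiLp.inner_apply, PiLp.inner_apply]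
    simp only [Fin.sum_univ_two, Real.norm_eq_abs, sq_abs]
    simp
    field_simp
    ring
  unfold fadA
  rw [hF, GaussianFourier.integral_cexp_neg_mul_sum_add (by simpa using ht)]
  have e1 : ((π : ℂ) / ((1 / t : ℝ) : ℂ)) ^ ((Fintype.card (Fin 2) : ℂ) / 2) = π * t := by
    simp
  rw [e1]
  unfold fadek
  rw [mul_left_comm, ← Complex.exp_add]
  push_cast
  congr 2
  have h0 : p 0 * q 0 + p 1 * q 1 = 0 := by
    rw [← hpq, PiLp.inner_apply]
    simp [Fin.sum_univ_two]; ring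
  have h0' : (p 0 : ℂ) * q 0 + p 1 * q 1 = 0 := by
    rw [← Complex.ofReal_mul, ← Complex.ofReal_mul, ← Complex.ofReal_add, h0, Complex.ofReal_zero]
  rw [← Complex.ofReal_pow, ← Complex.ofReal_pow, ← Complex.ofReal_pow]
  rw [EuclideanSpace.norm_sq_eq, EuclideanSpace.norm_sq_eq, EuclideanSpace.norm_sq_eq,
    PiLp.inner_apply, PiLp.inner_apply]
  simp only [Fin.sum_univ_two, Real.norm_eq_abs, sq_abs, fadk]
  simp
  field_simp
  have hI := Complex.I_sq
  linear_combination (8 * Complex.I) * h0' + (t ^ 2 * ((x 0 : ℂ) ^ 2 + (x 1 : ℂ) ^ 2) + 4 * ((q 0 : ℂ) ^ 2 + (q 1 : ℂ) ^ 2)) * hI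

lemma fad_pow_bound (n : ℕ) {a : ℝ} (ha : 0 ≤ a) :
    a ^ n * Real.exp (-(a ^ 2 / 2)) ≤ n.factorial * Real.exp (1 / 2) := by
  have h1 : Real.exp (-(a ^ 2 / 2)) ≤ Real.exp (1 / 2) * Real.exp (-a) := by
    rw [← Real.exp_add]
    apply Real.exp_le_exp.2
    nlinarith [sq_nonneg (a - 1)]
  have h2 : a ^ n * Real.exp (-a) ≤ n.factorial := by
    have := Real.pow_div_factorial_le_exp a ha n
    rw [div_le_iff₀ (by positivity)] at this
    rw [Real.exp_neg, ← div_eq_mul_inv, div_le_iff₀ (Real.exp_pos a)]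
    linarith
  calc a ^ n * Real.exp (-(a ^ 2 / 2)) ≤ a ^ n * (Real.exp (1 / 2) * Real.exp (-a)) := by gcongr
    _ = (a ^ n * Real.exp (-a)) * Real.exp (1 / 2) := by ring
    _ ≤ _ := by gcongr

lemma fad_dom {w m : FadV → ℂ} (hw : Measurable w)
    (H : Integrable (fun ξ : FadV => (1 + ‖ξ‖)⁻¹ * ‖w ξ‖)) (hm : AEStronglyMeasurable m)
    (C : ℝ) (hC : ∀ ξ, ‖m ξ‖ * (1 + ‖ξ‖) ≤ C) : Integrable (fun ξ => m ξ * w ξ) := by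
  refine (H.const_mul C).mono' (hm.mul hw.aestronglyMeasurable) ?_
  refine Filter.Eventually.of_forall fun ξ => ?_
  have hpos : 0 < 1 + ‖ξ‖ := by positivity
  rw [norm_mul, ← mul_assoc]
  gcongr
  rw [← div_eq_mul_inv, le_div_iff₀ hpos]
  exact hC ξ

lemma fad_h1_dec (p q : FadV) {w : FadV → ℂ} (hw : Measurable w)
    (H : Integrable (fun ξ : FadV => (1 + ‖ξ‖)⁻¹ * ‖w ξ‖)) :
    fadDec (fun ξ => Complex.exp (-(fadP p q ξ / ((1:ℝ) : ℂ))) * w ξ) := by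
  have hc := fadP_continuous p q
  have hm : AEStronglyMeasurable (fun ξ => Complex.exp (-(fadP p q ξ / ((1:ℝ) : ℂ)))) :=
    Continuous.aestronglyMeasurable (by fun_prop)
  refine ⟨hm.mul hw.aestronglyMeasurable, fun n => ?_⟩
  have := fad_dom (m := fun ξ => ((‖ξ‖ ^ n : ℝ) : ℂ) *
    Complex.exp (-(fadP p q ξ / ((1:ℝ) : ℂ)))) hw H
    (Continuous.aestronglyMeasurable (by fun_prop))
    (Real.exp (2 * ‖p‖ ^ 2 / 1) * (n.factorial * Real.exp (1 / 2) + (n + 1).factorial * Real.exp (1 / 2)))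
    ?_
  · refine this.norm.congr (Filter.Eventually.of_forall fun ξ => ?_)
    simp only [norm_mul, Complex.norm_real, norm_pow, norm_norm]
    ring
  · intro ξ
    have h1 := fadP_exp_norm p q ξ one_pos
    have h2 := fad_pow_bound n (norm_nonneg ξ)
    have h3 := fad_pow_bound (n + 1) (norm_nonneg ξ)
    rw [norm_mul, Complex.norm_real, norm_pow, norm_norm]
    calc ‖ξ‖ ^ n * ‖Complex.exp (-(fadP p q ξ / ((1:ℝ) : ℂ)))‖ * (1 + ‖ξ‖)
        ≤ ‖ξ‖ ^ n * (Real.exp (2 * ‖p‖ ^ 2 / 1) * Real.exp (-(‖ξ‖ ^ 2 / (2 * 1)))) * (1 + ‖ξ‖) := by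
          gcongr
      _ = Real.exp (2 * ‖p‖ ^ 2 / 1) * (‖ξ‖ ^ n * Real.exp (-(‖ξ‖ ^ 2 / 2)) +
            ‖ξ‖ ^ (n + 1) * Real.exp (-(‖ξ‖ ^ 2 / 2))) := by
          rw [mul_one]; ring
      _ ≤ _ := by gcongr

noncomputable def fadK (f : FadV → ℂ) (t : ℝ) (ξ : FadV) (s : ℝ) : ℂ :=
  if ‖ξ‖ ^ 2 / t ≤ s then ((Real.exp (-s) : ℝ) : ℂ) * f ξ else 0

lemma fadK_measurable {f : FadV → ℂ} (hf : Measurable f) (t : ℝ) :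
    Measurable (Function.uncurry (fadK f t)) := by
  unfold fadK Function.uncurry
  refine Measurable.ite (measurableSet_le (by fun_prop) (by fun_prop)) ?_ measurable_const
  fun_prop

lemma fad_exp_Ici (a : ℝ) : IntegrableOn (fun s : ℝ => Real.exp (-s)) (Set.Ici a) := by
  rw [integrableOn_Ici_iff_integrableOn_Ioi]
  simpa using! integrableOn_exp_mul_Ioi (a := -1) (by norm_num) a

lemma fad_exp_Ici_integral {a : ℝ} (ha : 0 ≤ a) :
    ∫ s in Set.Ici (0:ℝ), (if a ≤ s then Real.exp (-s) else 0) = Real.exp (-a) := by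
  have : (fun s : ℝ => if a ≤ s then Real.exp (-s) else 0) =
      (Set.Ici a).indicator (fun s => Real.exp (-s)) := by
    funext s; simp [Set.indicator]
  rw [this, setIntegral_indicator measurableSet_Ici,
    Set.inter_eq_self_of_subset_right (Set.Ici_subset_Ici.2 ha), integral_Ici_eq_integral_Ioi,
    integral_exp_neg_Ioi]

lemma fad_exp_Ici_integrable (a : ℝ) :
    Integrable (fun s : ℝ => if a ≤ s then Real.exp (-s) else 0)
      (volume.restrict (Set.Ici (0:ℝ))) := by
  have : (fun s : ℝ => if a ≤ s then Real.exp (-s) else 0) =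
      (Set.Ici a).indicator (fun s => Real.exp (-s)) := by
    funext s; simp [Set.indicator]
  rw [this]
  exact (fad_exp_Ici 0).indicator measurableSet_Ici

lemma fadK_eq (f : FadV → ℂ) (t : ℝ) (ξ : FadV) (s : ℝ) :
    fadK f t ξ s = ((if ‖ξ‖ ^ 2 / t ≤ s then Real.exp (-s) else 0 : ℝ) : ℂ) * f ξ := by
  unfold fadK
  split_ifs <;> simp

lemma fad_abel_int {f : FadV → ℂ} (hf : Measurable f)
    (H : Integrable (fun ξ : FadV => (1 + ‖ξ‖)⁻¹ * ‖f ξ‖)) {t : ℝ} (ht : 1 ≤ t) :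
    Integrable (fun ξ : FadV => ((Real.exp (-(‖ξ‖ ^ 2 / t)) : ℝ) : ℂ) * f ξ) := by
  have ht0 : 0 < t := by linarith
  refine fad_dom hf H (Continuous.aestronglyMeasurable (by fun_prop)) (1 + t) (fun ξ => ?_)
  rw [Complex.norm_real, Real.norm_eq_abs, Real.abs_exp, Real.exp_neg]
  have h1 := Real.add_one_le_exp (‖ξ‖ ^ 2 / t)
  have h2 : 0 < Real.exp (‖ξ‖ ^ 2 / t) := Real.exp_pos _
  rw [inv_mul_le_iff₀ h2]
  have h3 : ‖ξ‖ ≤ t + ‖ξ‖ ^ 2 / t := by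
    have : 0 ≤ t + ‖ξ‖ ^ 2 / t - ‖ξ‖ := by
      have e : t + ‖ξ‖ ^ 2 / t - ‖ξ‖ = ((t - ‖ξ‖ / 2) ^ 2 + 3 / 4 * ‖ξ‖ ^ 2) / t := by
        field_simp; ring
      rw [e]; positivity
    linarith
  have h4 : 0 ≤ ‖ξ‖ ^ 2 / t := by positivity
  nlinarith

lemma fadK_integrable {f : FadV → ℂ} (hf : Measurable f)
    (H : Integrable (fun ξ : FadV => (1 + ‖ξ‖)⁻¹ * ‖f ξ‖)) {t : ℝ} (ht : 1 ≤ t) :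
    Integrable (Function.uncurry (fadK f t))
      ((volume : Measure FadV).prod (volume.restrict (Set.Ici (0:ℝ)))) := by
  have ht0 : 0 < t := by linarith
  rw [integrable_prod_iff (fadK_measurable hf t).aestronglyMeasurable]
  constructor
  · refine Filter.Eventually.of_forall fun ξ => ?_
    simp only [Function.uncurry, fadK_eq]
    exact ((fad_exp_Ici_integrable _).ofReal).mul_const _
  · refine (fad_abel_int hf H ht).norm.congr (Filter.Eventually.of_forall fun ξ => ?_)
    simp only [Function.uncurry, fadK_eq, norm_mul, Complex.norm_real]
    rw [integral_mul_const]
    congr 1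
    rw [Real.norm_eq_abs, Real.abs_exp, ← fad_exp_Ici_integral (a := ‖ξ‖ ^ 2 / t) (by positivity)]
    congr 1
    funext s
    split_ifs <;> simp

lemma fad_abel_identity {f : FadV → ℂ} (hf : Measurable f)
    (H : Integrable (fun ξ : FadV => (1 + ‖ξ‖)⁻¹ * ‖f ξ‖)) {t : ℝ} (ht : 1 ≤ t) :
    ∫ ξ, ((Real.exp (-(‖ξ‖ ^ 2 / t)) : ℝ) : ℂ) * f ξ =
      ∫ s in Set.Ici (0:ℝ), ∫ ξ, fadK f t ξ s := by
  have ht0 : 0 < t := by linarith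
  rw [← integral_integral_swap (fadK_integrable hf H ht)]
  congr 1
  funext ξ
  simp only [fadK_eq]
  rw [integral_mul_const, integral_complex_ofReal, fad_exp_Ici_integral (by positivity)]

lemma fadK_ball (f : FadV → ℂ) {t s : ℝ} (ht : 0 < t) (hs : 0 ≤ s) :
    ∫ ξ, fadK f t ξ s = ((Real.exp (-s) : ℝ) : ℂ) *
      ∫ ξ in Metric.closedBall (0 : FadV) (√(t * s)), f ξ := by
  rw [← integral_const_mul, ← integral_indicator measurableSet_closedBall]
  congr 1
  funext ξ
  have : ‖ξ‖ ^ 2 / t ≤ s ↔ ξ ∈ Metric.closedBall (0 : FadV) (√(t * s)) := by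
    rw [mem_closedBall_zero_iff, Real.le_sqrt (norm_nonneg ξ), div_le_iff₀ ht, mul_comm s]
    exact mul_nonneg ht.le hs
  by_cases h : ‖ξ‖ ^ 2 / t ≤ s
  · rw [Set.indicator_of_mem (this.1 h), fadK, if_pos h]
  · rw [Set.indicator_of_notMem (mt this.2 h), fadK, if_neg h]

lemma fad_ball_int {f : FadV → ℂ} (hf : Measurable f)
    (H : Integrable (fun ξ : FadV => (1 + ‖ξ‖)⁻¹ * ‖f ξ‖)) (N : ℝ) :
    IntegrableOn f (Metric.closedBall 0 N) := by
  rw [← integrable_indicator_iff measurableSet_closedBall]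
  have := fad_dom (m := (Metric.closedBall (0 : FadV) N).indicator (fun _ => (1:ℂ))) hf H
    ((measurable_const.indicator measurableSet_closedBall).aestronglyMeasurable) (1 + |N|)
    (fun ξ => ?_)
  · refine this.congr (Filter.Eventually.of_forall fun ξ => ?_)
    by_cases h : ξ ∈ Metric.closedBall (0 : FadV) N <;> simp [Set.indicator, h]
  · by_cases h : ξ ∈ Metric.closedBall (0 : FadV) N
    · have h' := mem_closedBall_zero_iff.1 h
      simp only [Set.indicator, h, if_true, norm_one, one_mul]
      linarith [le_abs_self N]
    · simp only [Set.indicator, h, if_false, norm_zero, zero_mul]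
      positivity

lemma fad_ball_bound {f : FadV → ℂ} (hf : Measurable f)
    (H : Integrable (fun ξ : FadV => (1 + ‖ξ‖)⁻¹ * ‖f ξ‖)) {L : ℂ}
    (hL : Tendsto (fun N : ℝ => ∫ ξ in Metric.closedBall (0 : FadV) N, f ξ) atTop (𝓝 L)) :
    ∃ C : ℝ, ∀ N, ‖∫ ξ in Metric.closedBall (0 : FadV) N, f ξ‖ ≤ C := by
  have h1 : ∀ᶠ N : ℝ in atTop, ‖∫ ξ in Metric.closedBall (0 : FadV) N, f ξ‖ < ‖L‖ + 1 :=
    hL.norm.eventually (gt_mem_nhds (by linarith))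
  obtain ⟨N0, hN0⟩ := Filter.eventually_atTop.1 h1
  refine ⟨max (‖L‖ + 1) (∫ ξ in Metric.closedBall (0 : FadV) N0, ‖f ξ‖), fun N => ?_⟩
  rcases le_total N0 N with h | h
  · exact (hN0 N h).le.trans (le_max_left _ _)
  · refine le_trans ?_ (le_max_right _ _)
    refine (norm_integral_le_integral_norm _).trans ?_
    refine setIntegral_mono_set (fad_ball_int hf H N0).norm
      (Filter.Eventually.of_forall fun _ => norm_nonneg _) ?_
    exact (Metric.closedBall_subset_closedBall h).eventuallyLE

lemma fad_abel {f : FadV → ℂ} (hf : Measurable f)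
    (H : Integrable (fun ξ : FadV => (1 + ‖ξ‖)⁻¹ * ‖f ξ‖)) {L : ℂ}
    (hL : Tendsto (fun N : ℝ => ∫ ξ in Metric.closedBall (0 : FadV) N, f ξ) atTop (𝓝 L)) :
    Tendsto (fun t : ℝ => ∫ ξ, ((Real.exp (-(‖ξ‖ ^ 2 / t)) : ℝ) : ℂ) * f ξ) atTop (𝓝 L) := by
  obtain ⟨C, hC⟩ := fad_ball_bound hf H hL
  have hlim : L = ∫ s in Set.Ici (0:ℝ), ((Real.exp (-s) : ℝ) : ℂ) * L := by
    rw [integral_mul_const, integral_complex_ofReal, integral_Ici_eq_integral_Ioi,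
      integral_exp_neg_Ioi]
    simp
  have key : Tendsto (fun t : ℝ => ∫ s in Set.Ici (0:ℝ), ∫ ξ, fadK f t ξ s) atTop (𝓝 L) := by
    rw [hlim]
    refine tendsto_integral_filter_of_dominated_convergence (fun s => Real.exp (-s) * C) ?_ ?_ ?_ ?_
    · filter_upwards [eventually_ge_atTop 1] with t ht
      exact (fadK_integrable hf H ht).integral_prod_right.1
    · filter_upwards [eventually_ge_atTop 1] with t ht
      filter_upwards [ae_restrict_mem measurableSet_Ici] with s hs
      rw [fadK_ball f (by linarith) hs, norm_mul, Complex.norm_real, Real.norm_eq_abs, Real.abs_exp]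
      gcongr
      exact hC _
    · exact (fad_exp_Ici 0).mul_const C
    · have h0 : ∀ᵐ s ∂(volume.restrict (Set.Ici (0:ℝ))), s ≠ 0 := by
        refine ae_restrict_of_ae ?_
        exact Measure.ae_ne volume (0:ℝ)
      filter_upwards [ae_restrict_mem measurableSet_Ici, h0] with s hs hs0
      have hs' : 0 < s := lt_of_le_of_ne hs (Ne.symm hs0)
      have h1 : Tendsto (fun t : ℝ => √(t * s)) atTop atTop :=
        Real.tendsto_sqrt_atTop.comp (tendsto_id.atTop_mul_const hs')
      refine ((hL.comp h1).const_mul ((Real.exp (-s) : ℝ) : ℂ)).congr' ?_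
      filter_upwards [eventually_ge_atTop 1] with t ht
      rw [fadK_ball f (by linarith) hs]
      rfl
  refine key.congr' ?_
  filter_upwards [eventually_ge_atTop 1] with t ht
  rw [fad_abel_identity hf H ht]

lemma fadW_meas (p q : FadV) : Measurable (fun ξ => (fadP p q ξ)⁻¹) :=
  (fadP_continuous p q).measurable.inv

lemma fad_H (p q : FadV)
    (hloc : ∀ N : ℝ, IntegrableOn (fun ξ => (fadP p q ξ)⁻¹) (Metric.closedBall 0 N)) :
    Integrable (fun ξ : FadV => (1 + ‖ξ‖)⁻¹ * ‖(fadP p q ξ)⁻¹‖) := by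
  have h1 := ((integrable_indicator_iff measurableSet_closedBall).2 (hloc (4 * ‖p‖ + 1))).norm
  have h2 : Integrable (fun ξ : FadV => (1 + ‖ξ‖) ^ (-(3:ℝ))) :=
    integrable_one_add_norm (by simp; norm_num)
  have hw := fadW_meas p q
  refine (h1.add (h2.const_mul 16)).mono' (Measurable.aestronglyMeasurable (by fun_prop)) ?_
  refine Filter.Eventually.of_forall fun ξ => ?_
  have ha := norm_nonneg ξ
  have hp := norm_nonneg p
  have hpos : 0 < 1 + ‖ξ‖ := by positivity
  rw [Real.norm_of_nonneg (by positivity), Pi.add_apply]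
  by_cases h : ‖ξ‖ ≤ 4 * ‖p‖ + 1
  · rw [Set.indicator_of_mem (mem_closedBall_zero_iff.2 h)]
    have h3 : (1 + ‖ξ‖)⁻¹ ≤ 1 := inv_le_one_of_one_le₀ (by linarith)
    have h4 : 0 ≤ 16 * (1 + ‖ξ‖) ^ (-(3:ℝ)) := by positivity
    have h5 := mul_le_mul_of_nonneg_right h3 (norm_nonneg (fadP p q ξ)⁻¹)
    linarith
  · rw [Set.indicator_of_notMem (fun hh => h (mem_closedBall_zero_iff.1 hh))]
    rw [norm_zero, zero_add]
    push Not at h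
    have h3 : (1 + ‖ξ‖) ^ 2 / 16 ≤ ‖fadP p q ξ‖ := by
      have e1 := fadP_re_ge p q ξ
      have e2 := (le_abs_self _).trans (Complex.abs_re_le_norm (fadP p q ξ))
      nlinarith
    have h4 : ‖(fadP p q ξ)⁻¹‖ ≤ 16 * ((1 + ‖ξ‖) ^ 2)⁻¹ := by
      rw [norm_inv]
      calc ‖fadP p q ξ‖⁻¹ ≤ ((1 + ‖ξ‖) ^ 2 / 16)⁻¹ := by gcongr
        _ = _ := by rw [inv_div, div_eq_mul_inv]
    have h5 : (1 + ‖ξ‖) ^ (-(3:ℝ)) = ((1 + ‖ξ‖) ^ 3)⁻¹ := by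
      rw [Real.rpow_neg hpos.le]
      norm_cast
    rw [h5]
    calc (1 + ‖ξ‖)⁻¹ * ‖(fadP p q ξ)⁻¹‖ ≤ (1 + ‖ξ‖)⁻¹ * (16 * ((1 + ‖ξ‖) ^ 2)⁻¹) := by gcongr
      _ = _ := by field_simp

lemma fad_diff_bound (p q ξ : FadV) {t : ℝ} (ht : 1 ≤ t) :
    ‖Complex.exp (-(fadP p q ξ / (t : ℂ))) - ((Real.exp (-(‖ξ‖ ^ 2 / t)) : ℝ) : ℂ)‖ * (1 + ‖ξ‖)
      ≤ 8 * (‖p‖ + ‖q‖) * Real.exp (2 * (‖p‖ + ‖q‖) ^ 2) := by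
  have ht0 : 0 < t := by linarith
  set κ := ‖p‖ + ‖q‖ with hκ
  have hκ0 : 0 ≤ κ := by positivity
  set a := ‖ξ‖ with ha
  have ha0 : 0 ≤ a := norm_nonneg ξ
  set z : ℂ := -((2 * ((inner ℝ p ξ : ℝ) : ℂ) + 2 * Complex.I * ((inner ℝ q ξ : ℝ) : ℂ)) / t) with hz
  have e1 : Complex.exp (-(fadP p q ξ / (t : ℂ))) - ((Real.exp (-(a ^ 2 / t)) : ℝ) : ℂ) =
      ((Real.exp (-(a ^ 2 / t)) : ℝ) : ℂ) * (Complex.exp z - 1) := by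
    rw [mul_sub, mul_one, Complex.ofReal_exp, ← Complex.exp_add]
    congr 2
    rw [hz, fadP]
    push_cast
    rw [← ha]
    ring
  have hzn : ‖z‖ ≤ 2 * κ * a / t := by
    rw [hz, norm_neg, norm_div, Complex.norm_real, Real.norm_of_nonneg ht0.le]
    gcongr
    refine (norm_add_le _ _).trans ?_
    simp only [norm_mul, Complex.norm_real, Complex.norm_I, Complex.norm_ofNat, Real.norm_eq_abs]
    have i1 := abs_real_inner_le_norm p ξ
    have i2 := abs_real_inner_le_norm q ξ
    rw [← ha] at i1 i2
    rw [hκ]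
    nlinarith
  have hexp : ‖Complex.exp z - 1‖ ≤ ‖z‖ * Real.exp ‖z‖ := by
    simpa using Complex.norm_exp_sub_sum_le_norm_mul_exp z 1
  have h2 : ‖Complex.exp z - 1‖ ≤ (2 * κ * a / t) * Real.exp (2 * κ * a / t) := by
    refine hexp.trans ?_
    gcongr
  have h3 : Real.exp (-(a ^ 2 / t)) * Real.exp (2 * κ * a / t) ≤
      Real.exp (2 * κ ^ 2) * Real.exp (-(a ^ 2 / (2 * t))) := by
    rw [← Real.exp_add, ← Real.exp_add]
    apply Real.exp_le_exp.2
    have e : 2 * κ ^ 2 + -(a ^ 2 / (2 * t)) - (-(a ^ 2 / t) + 2 * κ * a / t) =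
        ((a - 2 * κ) ^ 2 / 2 + 2 * κ ^ 2 * (t - 1)) / t := by
      field_simp
      ring
    have : 0 ≤ ((a - 2 * κ) ^ 2 / 2 + 2 * κ ^ 2 * (t - 1)) / t := by
      have : 0 ≤ t - 1 := by linarith
      positivity
    linarith
  have h4 : a * (1 + a) / t ≤ 4 * Real.exp (a ^ 2 / (2 * t)) := by
    have i1 := Real.add_one_le_exp (a ^ 2 / (2 * t))
    have e : 4 * (a ^ 2 / (2 * t) + 1) - a * (1 + a) / t = (a ^ 2 + 4 * t - a) / t := by
      field_simp
      ring
    have : 0 ≤ (a ^ 2 + 4 * t - a) / t := by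
      apply div_nonneg _ ht0.le
      nlinarith [sq_nonneg (a - 1)]
    linarith
  rw [e1, norm_mul, Complex.norm_real, Real.norm_eq_abs, Real.abs_exp]
  calc Real.exp (-(a ^ 2 / t)) * ‖Complex.exp z - 1‖ * (1 + a)
      ≤ Real.exp (-(a ^ 2 / t)) * ((2 * κ * a / t) * Real.exp (2 * κ * a / t)) * (1 + a) := by gcongr
    _ = 2 * κ * (a * (1 + a) / t) * (Real.exp (-(a ^ 2 / t)) * Real.exp (2 * κ * a / t)) := by ring
    _ ≤ 2 * κ * (4 * Real.exp (a ^ 2 / (2 * t))) *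
        (Real.exp (2 * κ ^ 2) * Real.exp (-(a ^ 2 / (2 * t)))) := by gcongr
    _ = 8 * κ * Real.exp (2 * κ ^ 2) * (Real.exp (a ^ 2 / (2 * t)) * Real.exp (-(a ^ 2 / (2 * t)))) := by
        ring
    _ = _ := by rw [← Real.exp_add, add_neg_cancel, Real.exp_zero, mul_one]

lemma fad_diff_int (p q : FadV) {f : FadV → ℂ} (hf : Measurable f)
    (H : Integrable (fun ξ : FadV => (1 + ‖ξ‖)⁻¹ * ‖f ξ‖)) {t : ℝ} (ht : 1 ≤ t) :
    Integrable (fun ξ => (Complex.exp (-(fadP p q ξ / (t : ℂ))) -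
      ((Real.exp (-(‖ξ‖ ^ 2 / t)) : ℝ) : ℂ)) * f ξ) := by
  have hc := fadP_continuous p q
  exact fad_dom hf H (Continuous.aestronglyMeasurable (by fun_prop)) _
    (fun ξ => fad_diff_bound p q ξ ht)

lemma fad_expf_int (p q : FadV) {f : FadV → ℂ} (hf : Measurable f)
    (H : Integrable (fun ξ : FadV => (1 + ‖ξ‖)⁻¹ * ‖f ξ‖)) {t : ℝ} (ht : 1 ≤ t) :
    Integrable (fun ξ => Complex.exp (-(fadP p q ξ / (t : ℂ))) * f ξ) := by
  refine ((fad_diff_int p q hf H ht).add (fad_abel_int hf H ht)).congr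
    (Filter.Eventually.of_forall fun ξ => ?_)
  simp only [Pi.add_apply]
  ring

lemma fad_diff_tendsto (p q : FadV) {f : FadV → ℂ} (hf : Measurable f)
    (H : Integrable (fun ξ : FadV => (1 + ‖ξ‖)⁻¹ * ‖f ξ‖)) :
    Tendsto (fun t : ℝ => ∫ ξ, (Complex.exp (-(fadP p q ξ / (t : ℂ))) -
      ((Real.exp (-(‖ξ‖ ^ 2 / t)) : ℝ) : ℂ)) * f ξ) atTop (𝓝 0) := by
  have h0 : (0 : ℂ) = ∫ _ξ : FadV, (0 : ℂ) := by simp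
  rw [h0]
  refine tendsto_integral_filter_of_dominated_convergence
    (fun ξ => (8 * (‖p‖ + ‖q‖) * Real.exp (2 * (‖p‖ + ‖q‖) ^ 2)) * ((1 + ‖ξ‖)⁻¹ * ‖f ξ‖))
    ?_ ?_ (H.const_mul _) ?_
  · filter_upwards [eventually_ge_atTop 1] with t ht
    exact (fad_diff_int p q hf H ht).1
  · filter_upwards [eventually_ge_atTop 1] with t ht
    refine Filter.Eventually.of_forall fun ξ => ?_
    have hpos : 0 < 1 + ‖ξ‖ := by positivity
    rw [norm_mul, ← mul_assoc]
    gcongr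
    rw [← div_eq_mul_inv, le_div_iff₀ hpos]
    exact fad_diff_bound p q ξ ht
  · refine Filter.Eventually.of_forall fun ξ => ?_
    have h1 : Tendsto (fun t : ℝ => (t : ℂ)⁻¹) atTop (𝓝 0) := by
      have := (Complex.continuous_ofReal.tendsto 0).comp tendsto_inv_atTop_zero
      simpa [Function.comp_def] using this
    have h2 : Tendsto (fun t : ℝ => (Complex.exp (-(fadP p q ξ * (t : ℂ)⁻¹)) -
        Complex.exp (-((‖ξ‖ ^ 2 : ℝ) * (t : ℂ)⁻¹))) * f ξ) atTop
        (𝓝 ((Complex.exp (-(fadP p q ξ * 0)) - Complex.exp (-((‖ξ‖ ^ 2 : ℝ) * 0))) * f ξ)) := by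
      refine Tendsto.mul_const _ (Tendsto.sub ?_ ?_)
      · exact (Complex.continuous_exp.tendsto _).comp (h1.const_mul _).neg
      · exact (Complex.continuous_exp.tendsto _).comp (h1.const_mul _).neg
    simp only [mul_zero, sub_self, zero_mul] at h2
    refine h2.congr fun t => ?_
    simp [div_eq_mul_inv]

lemma fad_abelP (p q : FadV) {f : FadV → ℂ} (hf : Measurable f)
    (H : Integrable (fun ξ : FadV => (1 + ‖ξ‖)⁻¹ * ‖f ξ‖)) {L : ℂ}
    (hL : Tendsto (fun N : ℝ => ∫ ξ in Metric.closedBall (0 : FadV) N, f ξ) atTop (𝓝 L)) :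
    Tendsto (fun t : ℝ => ∫ ξ, Complex.exp (-(fadP p q ξ / (t : ℂ))) * f ξ) atTop (𝓝 L) := by
  have := (fad_diff_tendsto p q hf H).add (fad_abel hf H hL)
  rw [zero_add] at this
  refine this.congr' ?_
  filter_upwards [eventually_ge_atTop 1] with t ht
  rw [← integral_add (fad_diff_int p q hf H ht) (fad_abel_int hf H ht)]
  congr 1
  funext ξ
  ring

lemma fadP_ae (p : FadV) {q : FadV} (hq : q ≠ 0) : ∀ᵐ ξ, fadP p q ξ ≠ 0 := by
  have h1 : volume ((innerSL ℝ q).ker : Set FadV) = 0 := by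
    refine Measure.addHaar_submodule _ _ ?_
    intro h
    have : q ∈ (innerSL ℝ q).ker := by rw [h]; trivial
    have h2 : inner ℝ q q = (0:ℝ) := by simpa using this
    exact hq (inner_self_eq_zero.1 h2)
  have h2 : ∀ᵐ ξ, ξ ∉ ((innerSL ℝ q).ker : Set FadV) := measure_eq_zero_iff_ae_notMem.1 h1
  filter_upwards [h2] with ξ hξ h0
  apply hξ
  have : (fadP p q ξ).im = 0 := by rw [h0]; rfl
  simp [fadP, -Complex.ofReal_pow] at this
  simpa using this

lemma fad_deriv_t (p : FadV) {q : FadV} (hq : q ≠ 0)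
    (H : Integrable (fun ξ : FadV => (1 + ‖ξ‖)⁻¹ * ‖(fadP p q ξ)⁻¹‖)) (x : FadV)
    {t : ℝ} (ht : 1 ≤ t) :
    HasDerivAt (fun t : ℝ => fadF (fun ξ => Complex.exp (-(fadP p q ξ / (t : ℂ))) * (fadP p q ξ)⁻¹) x)
      (fadF (fun ξ => Complex.exp (-(fadP p q ξ / (t : ℂ)))) x / (t : ℂ) ^ 2) t := by
  have ht0 : 0 < t := by linarith
  have hw := fadW_meas p q
  have hc := fadP_continuous p q
  have key := hasDerivAt_integral_of_dominated_loc_of_deriv_le (μ := (volume : Measure FadV))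
    (F := fun (t : ℝ) ξ => Complex.exp (Complex.I * ((inner ℝ x ξ : ℝ) : ℂ)) *
      (Complex.exp (-(fadP p q ξ / (t : ℂ))) * (fadP p q ξ)⁻¹))
    (F' := fun (t : ℝ) ξ => Complex.exp (Complex.I * ((inner ℝ x ξ : ℝ) : ℂ)) *
      Complex.exp (-(fadP p q ξ / (t : ℂ))) * ((t : ℂ) ^ 2)⁻¹)
    (bound := fun ξ => (Real.exp (4 * ‖p‖ ^ 2 / t) * (4 / t ^ 2)) *
      Real.exp (-((1 / (4 * t)) * ‖ξ‖ ^ 2)))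
    (x₀ := t) (s := Set.Ioo (t / 2) (2 * t))
    (Ioo_mem_nhds (by linarith) (by linarith)) ?_ ?_ ?_ ?_ ?_ ?_
  · refine key.2.congr_deriv ?_
    unfold fadF
    rw [integral_mul_const, div_eq_mul_inv]
  · refine Filter.Eventually.of_forall fun t => Measurable.aestronglyMeasurable ?_
    have := hc.measurable
    fun_prop
  · exact fad_exp_int (fad_expf_int p q hw H ht) x
  · refine Continuous.aestronglyMeasurable ?_
    fun_prop
  · refine Filter.Eventually.of_forall fun ξ s hs => ?_
    have hs0 : 0 < s := by linarith [hs.1]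
    rw [norm_mul, norm_mul, mul_comm Complex.I, Complex.norm_exp_ofReal_mul_I, one_mul, norm_inv,
      norm_pow, Complex.norm_real, Real.norm_of_nonneg hs0.le]
    have h1 := fadP_exp_norm p q ξ hs0
    have h2 : Real.exp (2 * ‖p‖ ^ 2 / s) ≤ Real.exp (4 * ‖p‖ ^ 2 / t) := by
      apply Real.exp_le_exp.2
      rw [div_le_div_iff₀ hs0 ht0]
      nlinarith [hs.1, sq_nonneg ‖p‖]
    have h3 : Real.exp (-(‖ξ‖ ^ 2 / (2 * s))) ≤ Real.exp (-((1 / (4 * t)) * ‖ξ‖ ^ 2)) := by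
      apply Real.exp_le_exp.2
      apply neg_le_neg
      rw [one_div_mul_eq_div]
      have := hs.2
      exact div_le_div_of_nonneg_left (by positivity) (by positivity) (by linarith)
    have h4 : (s ^ 2)⁻¹ ≤ 4 / t ^ 2 := by
      rw [inv_eq_one_div, div_le_div_iff₀ (by positivity) (by positivity)]
      nlinarith [hs.1]
    calc _ ≤ (Real.exp (2 * ‖p‖ ^ 2 / s) * Real.exp (-(‖ξ‖ ^ 2 / (2 * s)))) * (s ^ 2)⁻¹ := by gcongr
      _ ≤ (Real.exp (4 * ‖p‖ ^ 2 / t) * Real.exp (-((1 / (4 * t)) * ‖ξ‖ ^ 2))) * (4 / t ^ 2) := by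
        gcongr
      _ = _ := by ring
  · exact (fad_gauss_int (by positivity)).const_mul _
  · filter_upwards [fadP_ae p hq] with ξ hξ s hs
    have hs0 : (s : ℂ) ≠ 0 := by
      have : 0 < s := by linarith [hs.1]
      exact_mod_cast this.ne'
    have d0 : HasDerivAt (fun s : ℝ => (s : ℂ)⁻¹) (-((s : ℂ) ^ 2)⁻¹) s := by
      have := (hasDerivAt_inv hs0).comp_ofReal
      simpa using this
    have d1 : HasDerivAt (fun s : ℝ => -(fadP p q ξ / (s : ℂ))) (fadP p q ξ * ((s : ℂ) ^ 2)⁻¹) s := by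
      have d2 := (d0.const_mul (-(fadP p q ξ)))
      refine (d2.congr_of_eventuallyEq (Filter.Eventually.of_forall fun s => ?_)).congr_deriv ?_
      · simp [div_eq_mul_inv]
      · ring
    have d3 := (d1.cexp.mul_const (fadP p q ξ)⁻¹).const_mul
      (Complex.exp (Complex.I * ((inner ℝ x ξ : ℝ) : ℂ)))
    refine d3.congr_deriv ?_
    field_simp

lemma fad_rep (p : FadV) {q : FadV} (hq : q ≠ 0) (hpq : (inner ℝ p q : ℝ) = 0)
    (H : Integrable (fun ξ : FadV => (1 + ‖ξ‖)⁻¹ * ‖(fadP p q ξ)⁻¹‖)) {x : FadV} (hx : x ≠ 0)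
    {L : ℂ}
    (hL : Tendsto (fun N : ℝ => ∫ ξ in Metric.closedBall (0 : FadV) N,
      Complex.exp (Complex.I * ((inner ℝ x ξ : ℝ) : ℂ)) * (fadP p q ξ)⁻¹) atTop (𝓝 L)) :
    fadek p q x * L =
      fadA p q (fun ξ => Complex.exp (-(fadP p q ξ / ((1:ℝ) : ℂ))) * (fadP p q ξ)⁻¹) x +
        π * fadWx (‖p‖ ^ 2 - ‖q‖ ^ 2) x := by
  have hw := fadW_meas p q
  have hr := fad_pos hx
  set r := ‖x‖ ^ 2 / 4 with hrdef
  set E := ‖p‖ ^ 2 - ‖q‖ ^ 2 with hE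
  set Φ : ℝ → ℂ := fun t => fadA p q
    (fun ξ => Complex.exp (-(fadP p q ξ / (t : ℂ))) * (fadP p q ξ)⁻¹) x with hΦ
  set φ : ℝ → ℂ := fun t => ((π * (fadW E t * Real.exp (-(r * t))) : ℝ) : ℂ) with hφ
  have hd : ∀ t : ℝ, 1 ≤ t → HasDerivAt Φ (φ t) t := by
    intro t ht
    have ht0 : 0 < t := by linarith
    refine ((fad_deriv_t p hq H x ht).const_mul (fadek p q x)).congr_deriv ?_
    have := fad_gauss p q hpq ht0 x
    unfold fadA at this
    rw [← mul_div_assoc, this, hφ]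
    simp only
    rw [← Complex.ofReal_pow, ← Complex.ofReal_div]
    congr 1
    rw [Real.exp_add, fadW, ← hrdef, ← hE, mul_comm t r]
    field_simp
  have hφi : IntegrableOn φ (Set.Ioi 1) :=
    ((fadNice_int (fadW_nice E) hr).const_mul π).ofReal
  have hφI : ∫ t in Set.Ioi (1:ℝ), φ t = π * fadWx E x := by
    rw [hφ, integral_complex_ofReal, integral_const_mul, fadWx, fadM]
    push_cast
    rfl
  have h1 : Tendsto (fun T : ℝ => ∫ t in (1:ℝ)..T, φ t) atTop (𝓝 (π * fadWx E x)) := by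
    rw [← hφI]
    exact intervalIntegral_tendsto_integral_Ioi 1 hφi tendsto_id
  have h2 : ∀ T : ℝ, 1 ≤ T → Φ T = Φ 1 + ∫ t in (1:ℝ)..T, φ t := by
    intro T hT
    rw [intervalIntegral.integral_eq_sub_of_hasDerivAt (f := Φ) (f' := φ)]
    · ring
    · intro t ht
      rw [Set.uIcc_of_le hT] at ht
      exact hd t ht.1
    · rw [intervalIntegrable_iff_integrableOn_Ioc_of_le hT]
      exact hφi.mono_set Set.Ioc_subset_Ioi_self
  have hf : Measurable (fun ξ : FadV =>
      Complex.exp (Complex.I * ((inner ℝ x ξ : ℝ) : ℂ)) * (fadP p q ξ)⁻¹) := by fun_prop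
  have hH : Integrable (fun ξ : FadV => (1 + ‖ξ‖)⁻¹ *
      ‖Complex.exp (Complex.I * ((inner ℝ x ξ : ℝ) : ℂ)) * (fadP p q ξ)⁻¹‖) := by
    refine H.congr (Filter.Eventually.of_forall fun ξ => ?_)
    simp only
    rw [norm_mul (Complex.exp _), mul_comm Complex.I, Complex.norm_exp_ofReal_mul_I, one_mul]
  have h3 : Tendsto Φ atTop (𝓝 (fadek p q x * L)) := by
    refine ((fad_abelP p q hf hH hL).const_mul (fadek p q x)).congr fun t => ?_
    rw [hΦ]
    simp only [fadA, fadF]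
    congr 2
    funext ξ
    ring
  have h4 : Tendsto Φ atTop (𝓝 (Φ 1 + π * fadWx E x)) := by
    refine (h1.const_add (Φ 1)).congr' ?_
    filter_upwards [eventually_ge_atTop 1] with T hT
    exact (h2 T hT).symm
  exact tendsto_nhds_unique h3 h4

lemma fadek_lap (p q : FadV) (hpq : (inner ℝ p q : ℝ) = 0) (x : FadV) :
    -laplacian2 (fadek p q) x = ((‖p‖ ^ 2 - ‖q‖ ^ 2 : ℝ) : ℂ) * fadek p q x := by
  rw [fad_lap_of (fun i y => Complex.I * fadk p q i * fadek p q y)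
    (fun i => Complex.I * fadk p q i * (Complex.I * fadk p q i * fadek p q x))
    (fun i => Filter.Eventually.of_forall fun y => fadek_fderiv p q y i) (fun i => ?_)]
  · have := fad_symbol p q hpq 0
    simp only [Fin.sum_univ_two] at this ⊢
    have h0 : fadP p q 0 = 0 := by simp [fadP]
    rw [h0, zero_add] at this
    rw [← this]
    simp
    linear_combination (-((fadk p q 0) ^ 2 + (fadk p q 1) ^ 2) * fadek p q x) * Complex.I_sq
  · have d1 : DifferentiableAt ℝ (fadek p q) x := (fadek_contDiff p q).differentiable (by simp) x
    rw [fderiv_const_mul d1]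
    simp [fadek_fderiv]

lemma fad_U (p : FadV) {q : FadV} (hq : q ≠ 0) (hpq : (inner ℝ p q : ℝ) = 0) (g : FadV → ℂ)
    (hg : ∀ x : FadV, x ≠ 0 → Tendsto (fun N : ℝ => ∫ ξ in Metric.closedBall (0 : FadV) N,
      Complex.exp (Complex.I * ((inner ℝ x ξ : ℝ) : ℂ)) * (fadP p q ξ)⁻¹) atTop
        (𝓝 (-((2 * Real.pi : ℝ) : ℂ) ^ 2 * g x))) :
    ∃ U : FadV → ℂ, ∀ x, x ≠ 0 → ContDiffAt ℝ 2 U x ∧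
      -laplacian2 U x = ((‖p‖ ^ 2 - ‖q‖ ^ 2 : ℝ) : ℂ) * U x ∧ fadek p q x * g x = U x := by
  have hc := fadP_continuous p q
  have hpi : ((2 * Real.pi : ℝ) : ℂ) ≠ 0 := by
    exact_mod_cast (by positivity : (2 * Real.pi : ℝ) ≠ 0)
  have hw := fadW_meas p q
  by_cases hloc : ∀ N : ℝ, IntegrableOn (fun ξ => (fadP p q ξ)⁻¹) (Metric.closedBall 0 N)
  · have H := fad_H p q hloc
    set h1 : FadV → ℂ := fun ξ => Complex.exp (-(fadP p q ξ / ((1:ℝ) : ℂ))) * (fadP p q ξ)⁻¹ with hh1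
    have hdec : fadDec h1 := fad_h1_dec p q hw H
    have hPe : (fun ξ => fadP p q ξ * h1 ξ) =ᵐ[volume]
        (fun ξ => Complex.exp (-(fadP p q ξ / ((1:ℝ) : ℂ)))) := by
      filter_upwards [fadP_ae p hq] with ξ hξ
      rw [hh1]
      field_simp
    have hPi : Integrable (fun ξ => fadP p q ξ * h1 ξ) := (fad_expP_int p q one_pos).congr hPe.symm
    have hAP : ∀ x, fadA p q (fun ξ => fadP p q ξ * h1 ξ) x =
        fadA p q (fun ξ => Complex.exp (-(fadP p q ξ / ((1:ℝ) : ℂ)))) x := by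
      intro x
      unfold fadA fadF
      congr 1
      refine integral_congr_ae ?_
      filter_upwards [hPe] with ξ hξ
      rw [hξ]
    set E := ‖p‖ ^ 2 - ‖q‖ ^ 2 with hE
    refine ⟨fun x => (-(((2 * Real.pi : ℝ) : ℂ) ^ 2)⁻¹) * (fadA p q h1 x + π * fadWx E x),
      fun x hx => ?_⟩
    have c1 : ContDiffAt ℝ 2 (fadA p q h1) x := (fadA_contDiff p q hdec).contDiffAt
    have c2 := fadWx_contDiffAt E hx
    have c3 : ContDiffAt ℝ 2 (fun x => (π : ℂ) * fadWx E x) x := contDiffAt_const.mul c2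
    have c4 : ContDiffAt ℝ 2 (fun x => fadA p q h1 x + π * fadWx E x) x := c1.add c3
    refine ⟨contDiffAt_const.mul c4, ?_, ?_⟩
    · rw [fad_lap_const_mul c4, fad_lap_add c1 c3, fad_lap_const_mul c2, fadWx_lap E hx]
      have e1 := fadA_lap p q hpq hdec hPi x
      rw [hAP, fad_gauss p q hpq one_pos] at e1
      rw [← hE, div_one, one_mul, mul_one, Complex.ofReal_mul] at e1
      linear_combination (-(((2 * Real.pi : ℝ) : ℂ) ^ 2)⁻¹) * e1
    · have e := fad_rep p hq hpq H hx (hg x hx)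
      rw [← hE, ← hh1] at e
      simp only
      rw [← e]
      field_simp
  · push Not at hloc
    obtain ⟨N0, hN0⟩ := hloc
    refine ⟨fun _ => 0, fun x hx => ⟨contDiffAt_const, ?_, ?_⟩⟩
    · simp [laplacian2]
    · have h0 : Tendsto (fun N : ℝ => ∫ ξ in Metric.closedBall (0 : FadV) N,
          Complex.exp (Complex.I * ((inner ℝ x ξ : ℝ) : ℂ)) * (fadP p q ξ)⁻¹) atTop (𝓝 0) := by
        refine tendsto_const_nhds.congr' ?_
        filter_upwards [eventually_ge_atTop N0] with N hN
        symm
        refine integral_undef fun hi => hN0 ?_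
        have hi2 : IntegrableOn (fun ξ => Complex.exp (Complex.I * ((inner ℝ x ξ : ℝ) : ℂ)) *
          (fadP p q ξ)⁻¹) (Metric.closedBall 0 N0) :=
          IntegrableOn.mono_set hi (Metric.closedBall_subset_closedBall hN)
        refine Integrable.mono hi2 hw.aestronglyMeasurable (Filter.Eventually.of_forall fun ξ => ?_)
        rw [norm_mul, mul_comm Complex.I, Complex.norm_exp_ofReal_mul_I, one_mul]
      have e := tendsto_nhds_unique (hg x hx) h0
      have : g x = 0 := by
        rcases mul_eq_zero.1 e with h | h
        · exact absurd (neg_eq_zero.1 h) (pow_ne_zero 2 hpi)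
        · exact h
      rw [this, mul_zero]

/-- Let `p, q ∈ ℝ²`, `q ≠ 0`, `p·q = 0`, `k := p + iq`, `E := |p|² − |q|²`, and let
`g(x) = −(2π)⁻²·lim_{N→∞} ∫_{‖ξ‖≤N} e^{i x·ξ}(‖ξ‖² + 2 p·ξ + 2i q·ξ)⁻¹ dξ` for `x ≠ 0`.
Then `G(x) := e^{i k·x} g(x)` is twice continuously differentiable on `ℝ²\{0}` and
satisfies `−ΔG = E·G` there; consequently for every `c ∈ ℂ` the function
`ψ(x) := e^{i k·x}(1 + c·g(x))` satisfies `−Δψ = Eψ` on `ℝ²\{0}`. -/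
theorem faddeev_eigenfunction_solves_schroedinger
    (p q : EuclideanSpace ℝ (Fin 2)) (hq : q ≠ 0) (hpq : (inner ℝ p q : ℝ) = 0)
    (g : EuclideanSpace ℝ (Fin 2) → ℂ)
    (hg : ∀ x : EuclideanSpace ℝ (Fin 2), x ≠ 0 →
      Tendsto
        (fun N : ℝ =>
          ∫ ξ in Metric.closedBall (0 : EuclideanSpace ℝ (Fin 2)) N,
            Complex.exp (Complex.I * ((inner ℝ x ξ : ℝ) : ℂ)) *
              (((‖ξ‖ ^ 2 + 2 * (inner ℝ p ξ : ℝ) : ℝ) : ℂ)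
                + 2 * Complex.I * ((inner ℝ q ξ : ℝ) : ℂ))⁻¹)
        atTop (𝓝 (-((2 * Real.pi : ℝ) : ℂ) ^ 2 * g x))) :
    ContDiffOn ℝ 2
      (fun x : EuclideanSpace ℝ (Fin 2) =>
        Complex.exp (Complex.I *
          (((inner ℝ p x : ℝ) : ℂ) + Complex.I * ((inner ℝ q x : ℝ) : ℂ))) * g x)
      {(0 : EuclideanSpace ℝ (Fin 2))}ᶜ ∧
    (∀ x : EuclideanSpace ℝ (Fin 2), x ≠ 0 →
      -laplacian2
          (fun y => Complex.exp (Complex.I *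
            (((inner ℝ p y : ℝ) : ℂ) + Complex.I * ((inner ℝ q y : ℝ) : ℂ))) * g y) x
        = ((‖p‖ ^ 2 - ‖q‖ ^ 2 : ℝ) : ℂ) *
            (Complex.exp (Complex.I *
              (((inner ℝ p x : ℝ) : ℂ) + Complex.I * ((inner ℝ q x : ℝ) : ℂ))) * g x)) ∧
    (∀ c : ℂ, ∀ x : EuclideanSpace ℝ (Fin 2), x ≠ 0 →
      -laplacian2
          (fun y => Complex.exp (Complex.I *
            (((inner ℝ p y : ℝ) : ℂ) + Complex.I * ((inner ℝ q y : ℝ) : ℂ)))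
            * (1 + c * g y)) x
        = ((‖p‖ ^ 2 - ‖q‖ ^ 2 : ℝ) : ℂ) *
            (Complex.exp (Complex.I *
              (((inner ℝ p x : ℝ) : ℂ) + Complex.I * ((inner ℝ q x : ℝ) : ℂ)))
              * (1 + c * g x))) := by
  obtain ⟨U, hU⟩ := fad_U p hq hpq g hg
  have hev : ∀ x : FadV, x ≠ 0 → (fun y => fadek p q y * g y) =ᶠ[𝓝 x] U := by
    intro x hx
    filter_upwards [isOpen_compl_singleton.mem_nhds hx] with y hy
    exact (hU y hy).2.2
  refine ⟨?_, ?_, ?_⟩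
  · intro x hx
    exact ((hU x hx).1.congr_of_eventuallyEq (hev x hx)).contDiffWithinAt
  · intro x hx
    have h1 := fad_lap_congr (hev x hx)
    have h2 := hU x hx
    rw [← h1, ← h2.2.2] at h2
    exact h2.2.1
  · intro c x hx
    have hU' := hU x hx
    have ck : ContDiffAt ℝ 2 (fadek p q) x := (fadek_contDiff p q).contDiffAt
    have cU : ContDiffAt ℝ 2 (fun y => c * U y) x := contDiffAt_const.mul hU'.1
    have hψ : (fun y => fadek p q y * (1 + c * g y)) =ᶠ[𝓝 x] (fun y => fadek p q y + c * U y) := by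
      filter_upwards [hev x hx] with y hy
      rw [← hy]
      ring
    have h1 := fad_lap_congr hψ
    rw [fad_lap_add ck cU, fad_lap_const_mul hU'.1] at h1
    have h2 := fadek_lap p q hpq x
    have h3 : -laplacian2 (fun y => fadek p q y * (1 + c * g y)) x =
        ((‖p‖ ^ 2 - ‖q‖ ^ 2 : ℝ) : ℂ) * (fadek p q x * (1 + c * g x)) := by
      rw [h1]
      linear_combination h2 + c * hU'.2.1 - ((‖p‖ ^ 2 - ‖q‖ ^ 2 : ℝ) : ℂ) * c * hU'.2.2
    exact h3
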